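/- arXiv:2305.17633 — 4 statements merged into one kernel-verified Lean document; each statement's English description precedes it below -/
import Mathlib

section
/- Let L, M, d be positive natural numbers. Let a_s be a real L×M matrix, ∇e_s a real L×d matrix, and ∇e_c a real M×d matrix. Define the per-sample embedding gradient g_E = a_sᵀ ∇e_s + ∇e_c (an M×d matrix; this corresponds to the shared-embedding gradient when the output one-hot matrix a_c is the identity). Then the squared Frobenius norm of g_E satisfies ‖g_E‖_F² = ⟨a_s a_sᵀ, ∇e_s ∇e_sᵀ⟩_F + ‖∇e_c‖_F² + 2·⟨∇e_s, a_s ∇e_c⟩_F. -/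
open Matrix

/-- Frobenius inner product of two real matrices of the same shape. -/
noncomputable def frobInner {m n : Type*} [Fintype m] [Fintype n]
    (A B : Matrix m n ℝ) : ℝ :=
  ∑ i, ∑ j, A i j * B i j

theorem frobInner_eq_trace {m n : Type*} [Fintype m] [Fintype n]
    (A B : Matrix m n ℝ) : frobInner A B = (Aᵀ * B).trace := by
  simp only [frobInner, trace, diag_apply, mul_apply, transpose_apply]
  exact Finset.sum_comm

/-- **Phantom Clipping identity.** For `g_E = a_sᵀ ∇e_s + ∇e_c`,
`‖g_E‖_F² = ⟨a_s a_sᵀ, ∇e_s ∇e_sᵀ⟩_F + ‖∇e_c‖_F² + 2⟨∇e_s, a_s ∇e_c⟩_F`. -/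
theorem phantom_clipping (L M d : ℕ) (hL : 0 < L) (hM : 0 < M) (hd : 0 < d)
    (a_s : Matrix (Fin L) (Fin M) ℝ)
    (es : Matrix (Fin L) (Fin d) ℝ)
    (ec : Matrix (Fin M) (Fin d) ℝ) :
    frobInner (a_sᵀ * es + ec) (a_sᵀ * es + ec) =
      frobInner (a_s * a_sᵀ) (es * esᵀ) + frobInner ec ec
        + 2 * frobInner es (a_s * ec) := by
  have cyclic : (a_s * a_sᵀ * (es * esᵀ)).trace = (esᵀ * a_s * (a_sᵀ * es)).trace := by
    rw [← Matrix.mul_assoc, trace_mul_comm]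
    simp only [Matrix.mul_assoc]
  have cross : (ecᵀ * (a_sᵀ * es)).trace = (esᵀ * (a_s * ec)).trace := by
    rw [← trace_transpose]
    simp only [transpose_mul, transpose_transpose, Matrix.mul_assoc]
  simp only [frobInner_eq_trace, transpose_add, transpose_mul, transpose_transpose,
    Matrix.add_mul, Matrix.mul_add, trace_add]
  rw [cyclic, cross, Matrix.mul_assoc esᵀ a_s ec]
  ring
end

section
/- Let n ≥ 1 and let x : Fin n → ℝ. Let γ = (γ_1, …, γ_n) be i.i.d. random variables each distributed according to the standard Gumbel measure. Then E[max_{1 ≤ j ≤ n} (x_j + γ_j)] = log(Σ_{j=1}^n exp(x_j)) + γ_EM, where γ_EM is the Euler–Mascheroni constant. Equivalently, the integral of the function γ ↦ max_j (x_j + γ_j) with respect to the n-fold product of the standard Gumbel measure equals log(Σ_j exp(x_j)) + γ_EM. -/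
open MeasureTheory Real

/-- The standard Gumbel probability measure on `ℝ`, with density
`t ↦ exp (-t - exp (-t))` with respect to Lebesgue measure. -/
noncomputable def stdGumbel : Measure ℝ :=
  volume.withDensity fun t => ENNReal.ofReal (Real.exp (-t - Real.exp (-t)))

theorem image_exp_neg_univ : (fun t : ℝ => Real.exp (-t)) '' Set.univ = Set.Ioi 0 := by
  ext u
  simp only [Set.image_univ, Set.mem_range, Set.mem_Ioi]
  exact ⟨fun ⟨t, ht⟩ => ht ▸ Real.exp_pos _, fun hu => ⟨-Real.log u, by simp [Real.exp_log hu]⟩⟩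

theorem image_exp_neg_Iic (a : ℝ) :
    (fun t : ℝ => Real.exp (-t)) '' Set.Iic a = Set.Ici (Real.exp (-a)) := by
  ext u
  simp only [Set.mem_image, Set.mem_Iic, Set.mem_Ici]
  refine ⟨fun ⟨t, hta, htu⟩ => htu ▸ Real.exp_le_exp.mpr (neg_le_neg hta), fun hu => ?_⟩
  have hu0 : 0 < u := (Real.exp_pos _).trans_le hu
  exact ⟨-Real.log u, neg_le.mp ((Real.le_log_iff_exp_le hu0).mpr hu), by simp [Real.exp_log hu0]⟩

theorem hasDerivAt_exp_neg (t : ℝ) :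
    HasDerivAt (fun t : ℝ => Real.exp (-t)) (-Real.exp (-t)) t := by
  simpa using (hasDerivAt_neg t).exp

theorem injective_exp_neg : Function.Injective fun t : ℝ => Real.exp (-t) :=
  fun _ _ h => neg_injective (Real.exp_injective h)

theorem measurable_gumbelDensity :
    Measurable fun t : ℝ => ENNReal.ofReal (Real.exp (-t - Real.exp (-t))) := by
  fun_prop

theorem stdGumbel_Iic (a : ℝ) :
    stdGumbel (Set.Iic a) = ENNReal.ofReal (Real.exp (-Real.exp (-a))) := by
  have hsub := lintegral_image_eq_lintegral_abs_deriv_mul measurableSet_Iic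
    (fun t _ => (hasDerivAt_exp_neg t).hasDerivWithinAt) (injective_exp_neg.injOn (s := Set.Iic a))
    (fun u => ENNReal.ofReal (Real.exp (-u)))
  rw [image_exp_neg_Iic, setLIntegral_congr Ioi_ae_eq_Ici.symm,
    ← ofReal_integral_eq_lintegral_ofReal (integrableOn_exp_neg_Ioi _)
      (Filter.Eventually.of_forall fun _ => (Real.exp_pos _).le), integral_exp_neg_Ioi] at hsub
  rw [stdGumbel, withDensity_apply _ measurableSet_Iic, hsub]
  refine lintegral_congr fun t => ?_
  rw [abs_neg, abs_of_pos (Real.exp_pos _), ← ENNReal.ofReal_mul (Real.exp_pos _).le,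
    ← Real.exp_add, sub_eq_add_neg]

instance : IsProbabilityMeasure stdGumbel where
  measure_univ := by
    refine tendsto_nhds_unique (tendsto_measure_Iic_atTop stdGumbel) ?_
    simp_rw [stdGumbel_Iic]
    have h : Filter.Tendsto (fun a : ℝ => Real.exp (-Real.exp (-a))) Filter.atTop (nhds 1) := by
      simpa [Function.comp_def] using (Real.continuous_exp.tendsto _).comp (Real.tendsto_exp_neg_atTop_nhds_zero).neg
    simpa using ENNReal.tendsto_ofReal h

theorem integral_log_mul_exp_neg_Ioi :
    ∫ u in Set.Ioi (0 : ℝ), Real.log u * Real.exp (-u) = -Real.eulerMascheroniConstant := by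
  have hderiv := Complex.hasDerivAt_GammaIntegral (s := 1) (by simp)
  have hGamma : Complex.Gamma =ᶠ[nhds 1] Complex.GammaIntegral := by
    filter_upwards [(isOpen_lt continuous_const Complex.continuous_re).mem_nhds
      (show (0 : ℝ) < (1 : ℂ).re by simp)] with s hs
    exact Complex.Gamma_eq_integral hs
  have h := (hderiv.congr_of_eventuallyEq hGamma).unique Complex.hasDerivAt_Gamma_one
  simp only [sub_self, Complex.cpow_zero, one_mul] at h
  norm_cast at h

theorem integral_id_stdGumbel : ∫ t, t ∂stdGumbel = Real.eulerMascheroniConstant := by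
  have hsub := integral_image_eq_integral_abs_deriv_smul MeasurableSet.univ
    (fun t _ => (hasDerivAt_exp_neg t).hasDerivWithinAt) injective_exp_neg.injOn
    (fun u => Real.log u * Real.exp (-u))
  rw [image_exp_neg_univ, integral_log_mul_exp_neg_Ioi, setIntegral_univ] at hsub
  rw [stdGumbel, integral_withDensity_eq_integral_toReal_smul measurable_gumbelDensity
    (by simp), ← neg_neg (Real.eulerMascheroniConstant), hsub, ← integral_neg]
  refine integral_congr_ae (Filter.Eventually.of_forall fun t => ?_)
  dsimp only
  rw [ENNReal.toReal_ofReal (Real.exp_pos _).le, abs_neg, abs_of_pos (Real.exp_pos _),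
    Real.log_exp, sub_eq_add_neg, Real.exp_add, smul_eq_mul, smul_eq_mul]
  ring

theorem integrable_id_stdGumbel : Integrable (fun t => t) stdGumbel := by
  by_contra h
  have h0 := integral_id_stdGumbel
  rw [integral_undef h] at h0
  linarith [Real.one_half_lt_eulerMascheroniConstant]

/-- The maximum of independent shifted Gumbel variables is a Gumbel variable shifted by the
log-sum-exp of the shifts. -/
theorem map_sup'_pi_stdGumbel {ι : Type*} [Fintype ι] (h : (Finset.univ : Finset ι).Nonempty)
    (x : ι → ℝ) :
    (Measure.pi fun _ : ι => stdGumbel).map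
        (fun γ => Finset.univ.sup' h fun j => x j + γ j) =
      stdGumbel.map fun t => Real.log (∑ j, Real.exp (x j)) + t := by
  have hmeas : Measurable fun γ : ι → ℝ => Finset.univ.sup' h fun j => x j + γ j :=
    (Continuous.finset_sup'_apply h fun j _ => by fun_prop).measurable
  refine Measure.ext_of_Iic _ _ fun a => ?_
  have hpre : (fun γ : ι → ℝ => Finset.univ.sup' h fun j => x j + γ j) ⁻¹' Set.Iic a =
      Set.univ.pi fun j => Set.Iic (a - x j) := by
    ext γ
    simp only [Set.mem_preimage, Set.mem_Iic, Finset.sup'_le_iff, Finset.mem_univ, true_imp_iff,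
      Set.mem_univ_pi, le_sub_iff_add_le']
  have hpre' (c : ℝ) : (fun t => c + t) ⁻¹' Set.Iic a = Set.Iic (a - c) := by
    ext t
    simp [le_sub_iff_add_le']
  rw [Measure.map_apply hmeas measurableSet_Iic,
    Measure.map_apply (measurable_const_add _) measurableSet_Iic, hpre, hpre', Measure.pi_pi]
  simp_rw [stdGumbel_Iic]
  rw [← ENNReal.ofReal_prod_of_nonneg fun _ _ => (Real.exp_pos _).le, ← Real.exp_sum]
  have hpos : 0 < ∑ j, Real.exp (x j) := Finset.sum_pos (fun _ _ => Real.exp_pos _) h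
  simp only [neg_sub, Real.exp_sub, Real.exp_log hpos, Finset.sum_neg_distrib, Finset.sum_div]

/-- **Gumbel-max (log-sum-exp) identity.** The expectation of
`max_j (x j + γ j)` over i.i.d. standard Gumbel noise `γ` equals
`log (∑ j, exp (x j)) + γ_EM`. -/
theorem gumbel_max_expectation (n : ℕ) (hn : 1 ≤ n) (x : Fin n → ℝ) :
    ∫ γ : Fin n → ℝ,
        Finset.univ.sup'
          (Finset.univ_nonempty_iff.mpr (Fin.pos_iff_nonempty.mp hn))
          (fun j => x j + γ j)
      ∂(Measure.pi fun _ => stdGumbel)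
    = Real.log (∑ j, Real.exp (x j)) + Real.eulerMascheroniConstant := by
  have h : (Finset.univ : Finset (Fin n)).Nonempty :=
    Finset.univ_nonempty_iff.mpr (Fin.pos_iff_nonempty.mp hn)
  have hcont : Continuous fun γ : Fin n → ℝ => Finset.univ.sup' h fun j => x j + γ j :=
    Continuous.finset_sup'_apply h fun j _ => by fun_prop
  rw [← integral_map (f := fun y : ℝ => y) hcont.measurable.aemeasurable
      measurable_id.aestronglyMeasurable,
    map_sup'_pi_stdGumbel h x,
    integral_map (f := fun y : ℝ => y) (measurable_const_add _).aemeasurable measurable_id.aestronglyMeasurable,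
    integral_add (integrable_const _) integrable_id_stdGumbel, integral_id_stdGumbel]
  simp
end

section
/- Let n ≥ 1 and let x : Fin n → ℝ. Let μ be the n-fold product of the standard Gumbel measure on ℝⁿ. Then the pushforward of μ under the map γ ↦ max_{1 ≤ j ≤ n} (x_j + γ_j) equals the pushforward of the standard Gumbel measure under the translation t ↦ t + log(Σ_{j=1}^n exp(x_j)). That is, the maximum of independently Gumbel-perturbed scores x_j is itself Gumbel distributed with location log-sum-exp of the scores. -/
open MeasureTheory Real

/-- The Gumbel density is the derivative of the Gumbel cumulative distribution function. -/
theorem hasDerivAt_exp_neg_exp_neg (t : ℝ) :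
    HasDerivAt (fun t : ℝ => Real.exp (-Real.exp (-t))) (Real.exp (-t - Real.exp (-t))) t := by
  have h : HasDerivAt (fun t : ℝ => -Real.exp (-t)) (-(Real.exp (-t) * -1)) t :=
    (hasDerivAt_neg t).exp.neg
  convert h.exp using 1
  rw [sub_eq_add_neg, Real.exp_add]
  ring

theorem tendsto_exp_neg_exp_neg_atBot :
    Filter.Tendsto (fun t : ℝ => Real.exp (-Real.exp (-t))) Filter.atBot (nhds 0) :=
  Real.tendsto_exp_atBot.comp (Filter.tendsto_neg_atTop_atBot.comp
    (Real.tendsto_exp_atTop.comp Filter.tendsto_neg_atBot_atTop))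

theorem tendsto_exp_neg_exp_neg_atTop :
    Filter.Tendsto (fun t : ℝ => Real.exp (-Real.exp (-t))) Filter.atTop (nhds 1) := by
  have h : Filter.Tendsto (fun t : ℝ => -Real.exp (-t)) Filter.atTop (nhds 0) := by
    simpa using (Real.tendsto_exp_atBot.comp Filter.tendsto_neg_atTop_atBot).neg
  simpa [Function.comp_def] using (Real.continuous_exp.tendsto 0).comp h

theorem integrableOn_exp_neg_sub_exp_neg_Iic (a : ℝ) :
    IntegrableOn (fun t : ℝ => Real.exp (-t - Real.exp (-t))) (Set.Iic a) := by
  have hc : Continuous fun t : ℝ => Real.exp (-t - Real.exp (-t)) := by fun_prop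
  refine integrableOn_Iic_of_intervalIntegral_norm_tendsto
    (Real.exp (-Real.exp (-a))) a (a := id) (l := Filter.atBot)
    (fun i => hc.integrableOn_Ioc) Filter.tendsto_id ?_
  have h (i : ℝ) : ∫ t in i..a, ‖Real.exp (-t - Real.exp (-t))‖
      = Real.exp (-Real.exp (-a)) - Real.exp (-Real.exp (-i)) := by
    simp only [Real.norm_eq_abs, Real.abs_exp]
    exact intervalIntegral.integral_eq_sub_of_hasDerivAt
      (fun t _ => hasDerivAt_exp_neg_exp_neg t) (hc.intervalIntegrable _ _)
  simp only [h, id]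
  simpa using tendsto_exp_neg_exp_neg_atBot.const_sub (Real.exp (-Real.exp (-a)))

instance isProbabilityMeasure_stdGumbel : IsProbabilityMeasure stdGumbel := by
  refine ⟨tendsto_nhds_unique (tendsto_measure_Iic_atTop stdGumbel) ?_⟩
  simp only [stdGumbel_Iic]
  simpa using ENNReal.tendsto_ofReal tendsto_exp_neg_exp_neg_atTop

/-- **Distributional Gumbel-max trick.** The maximum of independently
Gumbel-perturbed scores `x j` is Gumbel distributed with location
`log (∑ j, exp (x j))`. -/
theorem gumbel_max_distribution (n : ℕ) (hn : 1 ≤ n) (x : Fin n → ℝ) :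
    Measure.map
        (fun γ : Fin n → ℝ =>
          Finset.univ.sup'
            (Finset.univ_nonempty_iff.mpr (Fin.pos_iff_nonempty.mp hn))
            (fun j => x j + γ j))
        (Measure.pi fun _ => stdGumbel)
      = Measure.map (fun t : ℝ => t + Real.log (∑ j, Real.exp (x j))) stdGumbel := by
  have hne : (Finset.univ : Finset (Fin n)).Nonempty :=
    Finset.univ_nonempty_iff.mpr (Fin.pos_iff_nonempty.mp hn)
  have hpos : 0 < ∑ j, Real.exp (x j) := Finset.sum_pos (fun j _ => Real.exp_pos _) hne
  have hmax : Measurable fun γ : Fin n → ℝ => Finset.univ.sup' hne fun j => x j + γ j := by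
    have h : Continuous fun γ : Fin n → ℝ => Finset.univ.sup' hne fun j => x j + γ j :=
      Continuous.finset_sup'_apply hne fun j _ => by fun_prop
    exact h.measurable
  have hadd : Measurable fun t : ℝ => t + Real.log (∑ j, Real.exp (x j)) := by fun_prop
  have := Measure.isFiniteMeasure_map (Measure.pi fun _ : Fin n => stdGumbel)
    fun γ => Finset.univ.sup' hne fun j => x j + γ j
  refine Measure.ext_of_Iic _ _ fun a => ?_
  rw [Measure.map_apply hmax measurableSet_Iic, Measure.map_apply hadd measurableSet_Iic]
  have hpre : (fun γ : Fin n → ℝ => Finset.univ.sup' hne fun j => x j + γ j) ⁻¹' Set.Iic a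
      = Set.univ.pi fun j => Set.Iic (a - x j) := by
    ext γ
    simp [Finset.sup'_le_iff, Pi.le_def, le_sub_iff_add_le']
  rw [hpre, Measure.pi_pi, Set.preimage_add_const_Iic]
  simp only [stdGumbel_Iic]
  rw [← ENNReal.ofReal_prod_of_nonneg fun j _ => (Real.exp_pos _).le, ← Real.exp_sum,
    Finset.sum_neg_distrib]
  congr 3
  simp only [neg_sub, Real.exp_sub, Real.exp_log hpos, Finset.sum_div]
end

section
/- Let X₁ and X₂ be independent real random variables with X₁ distributed as the real Gaussian measure with mean μ₁ and variance σ₁², and X₂ distributed as the real Gaussian measure with mean μ₂ and variance σ₂², where σ₁² + σ₂² > 0. Set ν = √(σ₁² + σ₂²) and γ = (μ₁ − μ₂)/ν, and let Z = max(X₁, X₂). Then E[Z] = μ₁·Φ(γ) + μ₂·Φ(−γ) + ν·φ(γ), where Φ is the cumulative distribution function and φ the probability density function of the standard Gaussian distribution. -/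
open MeasureTheory ProbabilityTheory
open scoped NNReal

/-- Standard normal probability density function `φ`. -/
noncomputable def stdNormalPDF (t : ℝ) : ℝ :=
  Real.exp (-t ^ 2 / 2) / Real.sqrt (2 * Real.pi)

/-- Standard normal cumulative distribution function `Φ(t) = ∫_{-∞}^t φ(s) ds`. -/
noncomputable def stdNormalCDF (t : ℝ) : ℝ :=
  ∫ s in Set.Iic t, stdNormalPDF s

lemma stdNormalPDF_eq_gaussianPDFReal : stdNormalPDF = gaussianPDFReal 0 1 := by
  ext t
  simp [stdNormalPDF, gaussianPDFReal, div_eq_inv_mul]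

lemma integrable_stdNormalPDF : Integrable stdNormalPDF := by
  rw [stdNormalPDF_eq_gaussianPDFReal]
  exact integrable_gaussianPDFReal 0 1

lemma stdNormalPDF_neg (t : ℝ) : stdNormalPDF (-t) = stdNormalPDF t := by
  simp [stdNormalPDF]

lemma stdNormalCDF_neg (t : ℝ) : stdNormalCDF (-t) = 1 - stdNormalCDF t := by
  have h := integral_comp_neg_Iic (-t) stdNormalPDF
  simp only [stdNormalPDF_neg, neg_neg] at h
  have h_total : ∫ s, stdNormalPDF s = 1 := by
    rw [stdNormalPDF_eq_gaussianPDFReal]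
    exact integral_gaussianPDFReal_eq_one 0 one_ne_zero
  have h_split := intervalIntegral.integral_Iic_add_Ioi (b := t)
    integrable_stdNormalPDF.integrableOn integrable_stdNormalPDF.integrableOn
  rw [h_total] at h_split
  rw [stdNormalCDF, stdNormalCDF, h]
  linarith

lemma integrable_id_mul_stdNormalPDF : Integrable fun t ↦ t * stdNormalPDF t := by
  convert (integrable_mul_exp_neg_mul_sq (b := 1 / 2) (by norm_num)).div_const
    (Real.sqrt (2 * Real.pi)) using 2 with t
  rw [stdNormalPDF, mul_div_assoc]
  ring_nf

lemma hasDerivAt_stdNormalPDF (t : ℝ) :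
    HasDerivAt stdNormalPDF (-(t * stdNormalPDF t)) t := by
  have h : HasDerivAt (fun x : ℝ ↦ -x ^ 2 / 2) (-t) t :=
    ((hasDerivAt_pow 2 t).fun_neg.div_const 2).congr_deriv (by push_cast; ring)
  refine (h.exp.div_const (Real.sqrt (2 * Real.pi))).congr_deriv ?_
  rw [stdNormalPDF]
  ring

lemma integral_Iic_id_mul_stdNormalPDF (t : ℝ) :
    ∫ s in Set.Iic t, s * stdNormalPDF s = -stdNormalPDF t := by
  have h_lim : Filter.Tendsto stdNormalPDF Filter.atBot (nhds 0) :=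
    tendsto_zero_of_hasDerivAt_of_integrableOn_Iic (a := t)
      (fun x _ ↦ hasDerivAt_stdNormalPDF x)
      integrable_id_mul_stdNormalPDF.neg.integrableOn integrable_stdNormalPDF.integrableOn
  have h := integral_Iic_of_hasDerivAt_of_tendsto' (a := t)
    (fun x _ ↦ hasDerivAt_stdNormalPDF x) integrable_id_mul_stdNormalPDF.neg.integrableOn h_lim
  rw [integral_neg] at h
  linarith

/-- The expected positive part of `c - S` for a standard normal `S`. -/
lemma integral_max_const_sub_gaussianReal (c : ℝ) :
    ∫ s, max (c - s) 0 ∂gaussianReal 0 1 = c * stdNormalCDF c + stdNormalPDF c := by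
  have h_indicator : (fun s ↦ gaussianPDFReal 0 1 s • max (c - s) 0) =
      (Set.Iic c).indicator fun s ↦ c * stdNormalPDF s - s * stdNormalPDF s := by
    ext s
    rw [← stdNormalPDF_eq_gaussianPDFReal, smul_eq_mul]
    by_cases hs : s ≤ c
    · rw [Set.indicator_of_mem (Set.mem_Iic.mpr hs), max_eq_left (by linarith)]
      ring
    · rw [Set.indicator_of_notMem (by simpa using hs), max_eq_right (by linarith), mul_zero]
  rw [integral_gaussianReal_eq_integral_smul one_ne_zero, h_indicator,
    integral_indicator measurableSet_Iic,
    integral_sub (integrable_stdNormalPDF.const_mul c).integrableOn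
      integrable_id_mul_stdNormalPDF.integrableOn,
    integral_const_mul, integral_Iic_id_mul_stdNormalPDF, stdNormalCDF]
  ring

/-- The difference of independent Gaussians is Gaussian. -/
lemma hasLaw_sub_gaussianReal_of_indepFun {Ω : Type*} [MeasurableSpace Ω] {P : Measure Ω}
    {X Y : Ω → ℝ} {m₁ m₂ : ℝ} {v₁ v₂ : ℝ≥0} (hXY : IndepFun X Y P)
    (hX : HasLaw X (gaussianReal m₁ v₁) P) (hY : HasLaw Y (gaussianReal m₂ v₂) P) :
    HasLaw (X - Y) (gaussianReal (m₁ - m₂) (v₁ + v₂)) P := by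
  have h_neg : HasLaw (-Y) (gaussianReal (-m₂) v₂) P := gaussianReal_neg hY
  have h_ind : IndepFun X (-Y) P := hXY.comp measurable_id measurable_neg
  refine ⟨hX.aemeasurable.sub hY.aemeasurable, ?_⟩
  rw [sub_eq_add_neg, sub_eq_add_neg]
  exact gaussianReal_add_gaussianReal_of_indepFun h_ind hX.map_eq h_neg.map_eq

/-- **First moment of the max of two independent Gaussians**:
`E[max(X₁, X₂)] = μ₁ Φ(γ) + μ₂ Φ(−γ) + ν φ(γ)` with `ν = √(σ₁² + σ₂²)` and
`γ = (μ₁ − μ₂)/ν`. -/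
theorem max_gaussian_mean {Ω : Type*} [MeasurableSpace Ω]
    (P : Measure Ω) [IsProbabilityMeasure P]
    (X₁ X₂ : Ω → ℝ) (hX₁ : Measurable X₁) (hX₂ : Measurable X₂)
    (hind : IndepFun X₁ X₂ P)
    (μ₁ μ₂ : ℝ) (σ₁ σ₂ : ℝ≥0)
    (h₁ : Measure.map X₁ P = gaussianReal μ₁ (σ₁ ^ 2))
    (h₂ : Measure.map X₂ P = gaussianReal μ₂ (σ₂ ^ 2))
    (hσ : 0 < (σ₁ : ℝ) ^ 2 + (σ₂ : ℝ) ^ 2)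
    (ν γ : ℝ)
    (hν : ν = Real.sqrt ((σ₁ : ℝ) ^ 2 + (σ₂ : ℝ) ^ 2))
    (hγ : γ = (μ₁ - μ₂) / ν) :
    ∫ ω, max (X₁ ω) (X₂ ω) ∂P =
      μ₁ * stdNormalCDF γ + μ₂ * stdNormalCDF (-γ) + ν * stdNormalPDF γ := by
  have hν_pos : 0 < ν := hν ▸ Real.sqrt_pos.mpr hσ
  have hν_sq : ν ^ 2 = (σ₁ : ℝ) ^ 2 + (σ₂ : ℝ) ^ 2 := by rw [hν, Real.sq_sqrt hσ.le]
  have h_mean : ν * γ = μ₁ - μ₂ := by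
    rw [hγ]
    field_simp
  have law₁ : HasLaw X₁ (gaussianReal μ₁ (σ₁ ^ 2)) P := ⟨hX₁.aemeasurable, h₁⟩
  have law₂ : HasLaw X₂ (gaussianReal μ₂ (σ₂ ^ 2)) P := ⟨hX₂.aemeasurable, h₂⟩
  have int₁ : Integrable X₁ P :=
    (law₁.map_eq ▸ (memLp_id_gaussianReal 1).integrable le_rfl :
      Integrable id (P.map X₁)).comp_measurable hX₁
  have int₂ : Integrable X₂ P :=
    (law₂.map_eq ▸ (memLp_id_gaussianReal 1).integrable le_rfl :
      Integrable id (P.map X₂)).comp_measurable hX₂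
  have mean₂ : ∫ ω, X₂ ω ∂P = μ₂ := by
    rw [law₂.integral_eq]
    exact integral_id_gaussianReal
  have law_S : HasLaw (fun ω ↦ γ - (X₁ ω - X₂ ω) / ν) (gaussianReal 0 1) P := by
    convert gaussianReal_const_sub
      (gaussianReal_div_const (hasLaw_sub_gaussianReal_of_indepFun hind law₁ law₂) ν) γ using 2
    · rfl
    · rw [hγ, sub_self]
    · apply NNReal.eq
      push_cast
      rw [← hν_sq]
      exact (div_self (by positivity)).symm
  have h_max : ∀ ω, max (X₁ ω) (X₂ ω) =
      X₂ ω + ν * max (γ - (γ - (X₁ ω - X₂ ω) / ν)) 0 := by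
    intro ω
    rw [sub_sub_cancel, mul_max_of_nonneg _ _ hν_pos.le, mul_div_cancel₀ _ hν_pos.ne', mul_zero,
      ← max_add_add_left]
    simp
  have int_pos : Integrable (fun ω ↦ ν * max (γ - (γ - (X₁ ω - X₂ ω) / ν)) 0) P := by
    refine ((int₁.sup int₂).sub int₂).congr (.of_forall fun ω ↦ ?_)
    have := h_max ω
    simp only [Pi.sub_apply, Pi.sup_apply]
    linarith
  have h_pos := law_S.integral_comp (f := fun s ↦ max (γ - s) 0) (by fun_prop)
  simp only [Function.comp_def] at h_pos
  simp_rw [h_max]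
  rw [integral_add int₂ int_pos, integral_const_mul, h_pos, integral_max_const_sub_gaussianReal,
    mean₂, stdNormalCDF_neg]
  linear_combination stdNormalCDF γ * h_mean
end
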